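/- Let X be a compact metric space with covering dimension dim X ≤ n, and let m > ⌊n/2⌋. Then X admits a (⌊n/2⌋+1)-cover consisting of m subsets, each of covering dimension at most 1. -/

import Mathlib

/-- The Lebesgue covering dimension of a topological space, valued in `ℕ∞`:
the least `n` such that every open cover admits an open refinement in which every
point lies in at most `n + 1` members. -/
noncomputable def coveringDim (X : Type*) [TopologicalSpace X] : ℕ∞ :=
  sInf {N : ℕ∞ | ∃ n : ℕ, N = n ∧
    ∀ 𝒰 : Set (Set X), (∀ U ∈ 𝒰, IsOpen U) → ⋃₀ 𝒰 = Set.univ →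
      ∃ 𝒱 : Set (Set X), (∀ V ∈ 𝒱, IsOpen V) ∧ ⋃₀ 𝒱 = Set.univ ∧
        (∀ V ∈ 𝒱, ∃ U ∈ 𝒰, V ⊆ U) ∧
        ∀ x : X, {V | V ∈ 𝒱 ∧ x ∈ V}.encard ≤ (n : ℕ∞) + 1}

open Set Filter Topology

/-- A space of covering dimension at most `n` has open refinements of order at most `n + 1`. -/
lemma exists_refinement_of_coveringDim_le {X : Type*} [TopologicalSpace X] {n : ℕ}
    (h : coveringDim X ≤ n) (𝒰 : Set (Set X)) (hopen : ∀ U ∈ 𝒰, IsOpen U)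
    (hcov : ⋃₀ 𝒰 = univ) :
    ∃ 𝒱 : Set (Set X), (∀ V ∈ 𝒱, IsOpen V) ∧ ⋃₀ 𝒱 = univ ∧
      (∀ V ∈ 𝒱, ∃ U ∈ 𝒰, V ⊆ U) ∧
      ∀ x : X, {V | V ∈ 𝒱 ∧ x ∈ V}.encard ≤ (n : ℕ∞) + 1 := by
  rw [coveringDim] at h
  set S := {N : ℕ∞ | ∃ n : ℕ, N = n ∧ _}
  have hne : S.Nonempty := by
    by_contra hemp
    rw [not_nonempty_iff_eq_empty] at hemp
    simp [hemp] at h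
  obtain ⟨k, hk, hcover⟩ := csInf_mem hne
  rw [hk] at h
  obtain ⟨𝒱, hV, hVcov, hVU, hord⟩ := hcover 𝒰 hopen hcov
  exact ⟨𝒱, hV, hVcov, hVU, fun x => (hord x).trans (by gcongr)⟩

/-- Moving points along a moment curve makes a given subset of size at most `d` linearly
independent, outside the zeros of a nonzero polynomial in the displacement. -/
lemma exists_polynomial_moment_curve {ι : Type*} [Fintype ι] {d : ℕ} (a : ι → Fin d → ℝ)
    {s : ι → ℝ} (hs : Function.Injective s) {T : Finset ι} (hT : T.card ≤ d) :
    ∃ P : Polynomial ℝ, P ≠ 0 ∧ ∀ t : ℝ, P.eval t ≠ 0 → ∀ c : ι → ℝ, (∀ v ∉ T, c v = 0) →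
      (∀ j, ∑ v, c v * (a v j + t * s v ^ (j : ℕ)) = 0) → c = 0 := by
  let e := T.equivFin
  let A : Matrix (Fin T.card) (Fin T.card) ℝ :=
    Matrix.of fun i j => a (e.symm i) (j.castLE hT)
  let W := Matrix.vandermonde fun i => s (e.symm i)
  refine ⟨((Polynomial.X : Polynomial ℝ) • W.map Polynomial.C + A.map Polynomial.C).det, ?_, ?_⟩
  · intro h
    have hcoeff := Polynomial.coeff_det_X_add_C_card W A
    rw [h, Polynomial.coeff_zero] at hcoeff
    exact Matrix.det_vandermonde_ne_zero_iff.2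
      (hs.comp (Subtype.val_injective.comp e.symm.injective)) hcoeff.symm
  · intro t ht c hc hsum
    have hdet : (t • W + A).det ≠ 0 := by
      convert ht using 1
      rw [← Polynomial.coe_evalRingHom, RingHom.map_det]
      congr 1
      ext i j
      simp [mul_comm t]
    have hzero := Matrix.eq_zero_of_vecMul_eq_zero hdet (v := fun i => c (e.symm i)) (by
      ext j
      rw [Pi.zero_apply, ← hsum (j.castLE hT),
        ← Finset.sum_subset (Finset.subset_univ T) (fun v _ hv => by rw [hc v hv, zero_mul]),
        ← Finset.sum_coe_sort, ← e.symm.sum_comp]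
      rw [Matrix.vecMul, dotProduct]
      refine Finset.sum_congr rfl fun i _ => ?_
      simp only [A, W, Matrix.add_apply, Matrix.smul_apply, Matrix.vandermonde_apply,
        Matrix.of_apply, smul_eq_mul, Fin.val_castLE]
      ring)
    ext v
    by_cases hv : v ∈ T
    · simpa using congrFun hzero (e ⟨v, hv⟩)
    · exact hc v hv

/-- Finitely many points of `ℝᵈ` can be moved into general position by a small perturbation. -/
lemma exists_general_position {ι : Type*} [Fintype ι] {d : ℕ} (a : ι → Fin d → ℝ)
    {ε : ℝ} (hε : 0 < ε) :
    ∃ p : ι → Fin d → ℝ, (∀ v j, |p v j - a v j| < ε) ∧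
      ∀ (T : Finset ι) (c : ι → ℝ), T.card ≤ d → (∀ v ∉ T, c v = 0) →
        (∀ j, ∑ v, c v * p v j = 0) → c = 0 := by
  let s : ι → ℝ := fun v => (Fintype.equivFin ι v : ℕ)
  have hs : Function.Injective s :=
    Nat.cast_injective.comp (Fin.val_injective.comp (Fintype.equivFin ι).injective)
  have hgen : ∀ᶠ t in 𝓝[≠] (0 : ℝ), ∀ T : Finset ι, T.card ≤ d → ∀ c : ι → ℝ,
      (∀ v ∉ T, c v = 0) → (∀ j, ∑ v, c v * (a v j + t * s v ^ (j : ℕ)) = 0) → c = 0 := by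
    rw [eventually_all]
    intro T
    by_cases hT : T.card ≤ d
    · obtain ⟨P, hP, h⟩ := exists_polynomial_moment_curve a hs hT
      have : ∀ᶠ t in 𝓝[≠] (0 : ℝ), P.eval t ≠ 0 :=
        nhdsNE_le_cofinite 0 (by
          simpa [mem_cofinite, compl_def] using Polynomial.finite_setOfPred_isRoot hP)
      exact this.mono fun t ht _ => h t ht
    · exact Eventually.of_forall fun _ h => absurd h hT
  have hclose : ∀ᶠ t in 𝓝[≠] (0 : ℝ), ∀ v, ∀ j : Fin d, |t * s v ^ (j : ℕ)| < ε := by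
    refine eventually_nhdsWithin_of_eventually_nhds ?_
    simp only [eventually_all]
    intro v j
    have hcont : Continuous fun t : ℝ => |t * s v ^ (j : ℕ)| := by fun_prop
    exact hcont.continuousAt.eventually_lt_const (by simpa using hε)
  obtain ⟨t, htgen, htclose⟩ := (hgen.and hclose).exists
  exact ⟨fun v j => a v j + t * s v ^ (j : ℕ), by simpa using htclose,
    fun T c hT hc hsum => htgen T hT c hc hsum⟩

/-- On a compact metric space of dimension at most `n`, any `n + 1` real functions can be
uniformly approximated by functions without a common zero. -/
lemma exists_approx_no_common_zero {X : Type*} [MetricSpace X] [CompactSpace X] {n : ℕ}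
    (hdim : coveringDim X ≤ n) (f : Fin (n + 1) → C(X, ℝ)) {ε : ℝ} (hε : 0 < ε) :
    ∃ g : Fin (n + 1) → C(X, ℝ), (∀ j, dist (g j) (f j) < ε) ∧ ∀ x, ∃ j, g j x ≠ 0 := by
  have hε4 : 0 < ε / 4 := by positivity
  let O : X → Set X := fun y => {x | ∀ j, |f j y - f j x| < ε / 4}
  have hO : ∀ y, IsOpen (O y) := fun y => by
    simp only [O, ofPred_forall]
    exact isOpen_iInter_of_finite fun j => isOpen_lt (by fun_prop) continuous_const
  obtain ⟨𝒱, hVopen, hVcov, hVO, hord⟩ := exists_refinement_of_coveringDim_le hdim (range O)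
    (by rintro _ ⟨y, rfl⟩; exact hO y)
    (eq_univ_of_forall fun x => ⟨O x, mem_range_self x, fun j => by simpa using hε4⟩)
  obtain ⟨𝒲, hWV, hWfin, hWcov⟩ := isCompact_univ.elim_finite_subcover_image (c := id)
    hVopen (by simp [← sUnion_eq_biUnion, hVcov])
  have := hWfin.fintype
  obtain ⟨φ, hφ⟩ := PartitionOfUnity.exists_isSubordinate isClosed_univ
    (fun V : 𝒲 => (V : Set X)) (fun V => hVopen V (hWV V.2))
    (by rwa [biUnion_eq_iUnion] at hWcov)
  have hmem : ∀ (V : 𝒲) x, φ V x ≠ 0 → x ∈ (V : Set X) := fun V x h =>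
    hφ V (subset_tsupport _ h)
  have hsum : ∀ x, ∑ V, φ V x = 1 := fun x => by
    rw [← finsum_eq_sum_of_fintype]
    exact φ.sum_eq_one (mem_univ x)
  have hpt : ∀ V : 𝒲, ∃ y, (V : Set X) ⊆ O y := fun V => by
    obtain ⟨_, ⟨y, rfl⟩, hy⟩ := hVO V (hWV V.2)
    exact ⟨y, hy⟩
  choose y hy using hpt
  obtain ⟨p, hpclose, hpgen⟩ := exists_general_position (fun V j => f j (y V)) hε4
  refine ⟨fun j => ⟨fun x => ∑ V, φ V x * p V j, by fun_prop⟩, fun j => ?_, fun x => ?_⟩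
  · refine lt_of_le_of_lt ((ContinuousMap.dist_le (by positivity)).2 fun x => ?_)
      (half_lt_self hε)
    have hbound : ∀ V, |φ V x * (p V j - f j x)| ≤ φ V x * (ε / 2) := fun V => by
      rw [abs_mul, abs_of_nonneg (φ.nonneg V x)]
      rcases eq_or_ne (φ V x) 0 with h | h
      · simp [h]
      · refine mul_le_mul_of_nonneg_left ?_ (φ.nonneg V x)
        have h₁ := hpclose V j
        have h₂ := hy V (hmem V x h) j
        rw [abs_lt] at h₁ h₂
        exact abs_le.2 ⟨by linarith, by linarith⟩
    calc dist (∑ V, φ V x * p V j) (f j x) = |∑ V, φ V x * (p V j - f j x)| := by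
          simp only [mul_sub, Finset.sum_sub_distrib, ← Finset.sum_mul, hsum, one_mul,
            Real.dist_eq]
      _ ≤ ∑ V, φ V x * (ε / 2) :=
          (Finset.abs_sum_le_sum_abs _ _).trans (Finset.sum_le_sum fun V _ => hbound V)
      _ = ε / 2 := by rw [← Finset.sum_mul, hsum, one_mul]
  · by_contra! hzero
    classical
    have hcard : (Finset.univ.filter fun V => φ V x ≠ 0).card ≤ n + 1 := by
      have hle : ((Finset.univ.filter fun V => φ V x ≠ 0 : Finset 𝒲) : Set 𝒲).encard ≤ n + 1 :=
        (encard_le_encard_of_injOn (f := Subtype.val)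
          (t := {V | V ∈ 𝒱 ∧ x ∈ V})
          (fun V hV => ⟨hWV V.2, hmem V x (by simpa using hV)⟩)
          Subtype.val_injective.injOn).trans (hord x)
      rw [encard_coe_eq_coe_finsetCard] at hle
      exact_mod_cast hle
    have hφ0 := hpgen _ (fun V => φ V x) hcard (by simp) hzero
    have h1 := hsum x
    simp [fun V => congrFun hφ0 V] at h1

/-- A generic family of real functions on a compact metric space of dimension at most `n` has
no zero common to `n + 1` of its members, while each of countably many infinite subfamilies
is dense in the space of continuous functions. -/
lemma exists_dense_families_no_common_zero {X : Type*} [MetricSpace X] [CompactSpace X] {n : ℕ}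
    (hdim : coveringDim X ≤ n) (κ : Type*) [Countable κ] :
    ∃ F : κ × ℕ → C(X, ℝ), (∀ i, DenseRange fun j => F (i, j)) ∧
      ∀ e : Fin (n + 1) → κ × ℕ, Function.Injective e → ∀ x, ∃ a, F (e a) x ≠ 0 := by
  classical
  let B := {o ∈ TopologicalSpace.countableBasis C(X, ℝ) | o.Nonempty}
  have : Countable B :=
    ((TopologicalSpace.countable_countableBasis _).mono (sep_subset _ _)).to_subtype
  let D : κ × B → Set (κ × ℕ → C(X, ℝ)) := fun q => {F | ∃ j, F (q.1, j) ∈ (q.2 : Set C(X, ℝ))}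
  let E : {e : Fin (n + 1) → κ × ℕ // Function.Injective e} → Set (κ × ℕ → C(X, ℝ)) :=
    fun e => {F | ∀ x, ∃ a, F (e.1 a) x ≠ 0}
  have hDopen : ∀ q, IsOpen (D q) := fun q => by
    simp only [D, ofPred_exists]
    exact isOpen_iUnion fun j => (TopologicalSpace.isOpen_of_mem_countableBasis q.2.2.1).preimage
      (continuous_apply (A := fun _ : κ × ℕ => C(X, ℝ)) (q.1, j))
  have hDdense : ∀ q, Dense (D q) := by
    rintro ⟨i, o, ho, g, hg⟩ F
    refine mem_closure_of_tendsto (f := fun j : ℕ => Function.update F (i, j) g) (b := atTop)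
      (tendsto_pi_nhds.2 ?_) (Eventually.of_forall fun j => ⟨j, by simpa using hg⟩)
    rintro ⟨i', j'⟩
    refine tendsto_const_nhds.congr' ?_
    filter_upwards [eventually_gt_atTop j'] with j hj
    rw [Function.update_of_ne (by simp [hj.ne])]
  have hEopen : ∀ e, IsOpen (E e) := by
    intro e
    have hclosed : IsClosed {z : (κ × ℕ → C(X, ℝ)) × X | ∀ a, z.1 (e.1 a) z.2 = 0} := by
      simp only [ofPred_forall]
      exact isClosed_iInter fun a => isClosed_eq (by fun_prop) continuous_const
    convert (isClosedMap_fst_of_compactSpace _ hclosed).isOpen_compl using 1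
    ext F
    simp [E]
  have hEdense : ∀ e, Dense (E e) := by
    rintro ⟨e, he⟩ F
    choose g hg hg0 using fun k : ℕ => exists_approx_no_common_zero hdim (fun a => F (e a))
      (Nat.one_div_pos_of_nat (α := ℝ) (n := k))
    refine mem_closure_of_tendsto (f := fun k => Function.extend e (g k) F) (b := atTop)
      (tendsto_pi_nhds.2 fun z => ?_)
      (Eventually.of_forall fun k x => by simpa [he.extend_apply] using hg0 k x)
    by_cases hz : ∃ a, e a = z
    · obtain ⟨a, rfl⟩ := hz
      simp only [he.extend_apply]
      exact tendsto_iff_dist_tendsto_zero.2 (squeeze_zero (fun _ => dist_nonneg)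
        (fun k => (hg k a).le) tendsto_one_div_add_atTop_nhds_zero_nat)
    · simp only [Function.extend_apply' _ _ _ hz]
      exact tendsto_const_nhds
  obtain ⟨F, hF⟩ := (Dense.inter_of_Gδ (IsGδ.iInter_of_isOpen hDopen)
    (IsGδ.iInter_of_isOpen hEopen) (dense_iInter_of_isOpen hDopen hDdense)
    (dense_iInter_of_isOpen hEopen hEdense)).nonempty
  refine ⟨F, fun i => ?_, fun e he => mem_iInter.1 hF.2 ⟨e, he⟩⟩
  refine (TopologicalSpace.isBasis_countableBasis _).dense_iff.2 fun o ho hne => ?_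
  obtain ⟨j, hj⟩ := mem_iInter.1 hF.1 (i, ⟨o, ho, hne⟩)
  exact ⟨_, hj, j, rfl⟩

/-- The positivity sets of a dense sequence of functions on a compact metric space form a basis. -/
lemma exists_pos_subset_of_denseRange {X : Type*} [MetricSpace X] [CompactSpace X]
    {F : ℕ → C(X, ℝ)} (hF : DenseRange F) {x : X} {O : Set X} (hO : IsOpen O) (hx : x ∈ O) :
    ∃ j, 0 < F j x ∧ ∀ y, 0 < F j y → y ∈ O := by
  obtain ⟨r, hr, hball⟩ := Metric.isOpen_iff.1 hO x hx
  obtain ⟨j, hj⟩ := hF.exists_dist_lt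
    (⟨fun y => r / 2 - dist y x, by fun_prop⟩ : C(X, ℝ)) (half_pos hr)
  have hlt : ∀ y, |r / 2 - dist y x - F j y| < r / 2 := fun y =>
    (ContinuousMap.dist_apply_le_dist y).trans_lt hj
  refine ⟨j, ?_, fun y hy => hball ?_⟩
  · have := abs_lt.1 (hlt x)
    rw [dist_self] at this
    linarith
  · have := abs_lt.1 (hlt y)
    rw [Metric.mem_ball]
    linarith

/-- If `d + 1` bases are given by positivity sets of sequences of functions, then a set each of
whose points avoids all the zeros of one of the sequences has dimension at most `d`. -/
lemma coveringDim_le_of_avoids_zeros {X : Type*} [TopologicalSpace X] {d : ℕ} {A : Set X}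
    {f : Fin (d + 1) → ℕ → C(X, ℝ)}
    (hbasis : ∀ b x O, IsOpen O → x ∈ O → ∃ j, 0 < f b j x ∧ ∀ y, 0 < f b j y → y ∈ O)
    (hA : ∀ x ∈ A, ∃ b, ∀ j, f b j x ≠ 0) :
    coveringDim A ≤ d := by
  classical
  refine sInf_le ⟨d, rfl, fun 𝒰 hopen hcov => ?_⟩
  let P : Fin (d + 1) → ℕ → Prop := fun b j => ∃ U ∈ 𝒰, ∀ x : A, 0 < f b j x → x ∈ U
  let V : Fin (d + 1) → ℕ → Set A := fun b j =>
    {x | 0 < f b j x ∧ ∀ l < j, P b l → f b l x < 0}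
  have hdisj : ∀ b j l x, P b j → P b l → x ∈ V b j → x ∈ V b l → j = l := by
    intro b j l x hj hl hxj hxl
    rcases lt_trichotomy j l with h | h | h
    · exact absurd (hxl.2 j h hj) hxj.1.not_gt
    · exact h
    · exact absurd (hxj.2 l h hl) hxl.1.not_gt
  refine ⟨{W | ∃ b j, P b j ∧ W = V b j}, ?_, ?_, ?_, ?_⟩
  · rintro _ ⟨b, j, -, rfl⟩
    have hV : V b j = {x : A | 0 < f b j x} ∩ ⋂ l ∈ Iio j, ⋂ _ : P b l, {x : A | f b l x < 0} := by
      ext x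
      simp [V]
    rw [hV]
    refine (isOpen_lt (by fun_prop) (by fun_prop)).inter
      ((finite_Iio j).isOpen_biInter fun l _ => isOpen_iInter_of_finite fun _ =>
        isOpen_lt (by fun_prop) (by fun_prop))
  · refine eq_univ_of_forall fun x => ?_
    obtain ⟨b, hb⟩ := hA x x.2
    have hex : ∃ j, P b j ∧ 0 < f b j x := by
      obtain ⟨U, hU, hxU⟩ := mem_sUnion.1 (hcov.symm ▸ mem_univ x)
      obtain ⟨O, hO, rfl⟩ := isOpen_induced_iff.1 (hopen U hU)
      obtain ⟨j, hj, hsub⟩ := hbasis b x O hO hxU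
      exact ⟨j, ⟨_, hU, fun y hy => hsub y hy⟩, hj⟩
    refine ⟨V b (Nat.find hex), ⟨b, _, (Nat.find_spec hex).1, rfl⟩,
      (Nat.find_spec hex).2, fun l hl hP => ?_⟩
    exact lt_of_le_of_ne (not_lt.1 fun h => Nat.find_min hex hl ⟨hP, h⟩) (hb l)
  · rintro _ ⟨b, j, ⟨U, hU, hsub⟩, rfl⟩
    exact ⟨U, hU, fun x hx => hsub x hx.1⟩
  · intro x
    let W : Fin (d + 1) → Set A := fun b => {y | ∃ j, P b j ∧ x ∈ V b j ∧ y ∈ V b j}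
    have hsub : {U | U ∈ {W | ∃ b j, P b j ∧ W = V b j} ∧ x ∈ U} ⊆ range W := by
      rintro _ ⟨⟨b, j, hP, rfl⟩, hx⟩
      refine ⟨b, Set.ext fun y => ⟨?_, fun hy => ⟨j, hP, hx, hy⟩⟩⟩
      rintro ⟨l, hl, hxl, hy⟩
      rwa [hdisj b j l x hP hl hx hxl]
    refine (encard_le_encard hsub).trans ?_
    rw [← image_univ]
    refine (encard_image_le _ _).trans ?_
    simp

/-- Let `X` be a compact metric space with covering dimension at
most `n`, and `m > ⌊n/2⌋`. Then `X` admits a `(⌊n/2⌋+1)`-cover by `m` sets (every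
`⌊n/2⌋+1` of them cover `X`), each of covering dimension at most `1`. -/
theorem exists_nCover_one_dimensional (X : Type u) [MetricSpace X] [CompactSpace X]
    (n m : ℕ) (hdim : coveringDim X ≤ (n : ℕ∞)) (hm : n / 2 < m) :
    ∃ A : Fin m → Set X,
      (∀ s : Finset (Fin m), s.card = n / 2 + 1 → (⋃ i ∈ s, A i) = Set.univ) ∧
      (∀ i, coveringDim (A i) ≤ 1) := by
  obtain ⟨F, hdense, hF⟩ := exists_dense_families_no_common_zero hdim (Fin m × Fin 2)
  refine ⟨fun i => {x | ∃ b, ∀ j, F ((i, b), j) x ≠ 0}, fun s hs => ?_, fun i => ?_⟩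
  · refine eq_univ_of_forall fun x => ?_
    by_contra hx
    simp only [mem_iUnion, mem_ofPred_eq, not_exists, not_forall, not_not] at hx
    choose j hj using hx
    have hcard : Fintype.card (Fin (n + 1)) ≤ Fintype.card (s × Fin 2) := by
      simp only [Fintype.card_fin, Fintype.card_prod, Fintype.card_coe, hs]
      omega
    obtain ⟨e⟩ := Function.Embedding.nonempty_of_card_le hcard
    obtain ⟨a, ha⟩ := hF (fun a => (((e a).1, (e a).2), j _ (e a).1.2 (e a).2))
      (fun a a' h => e.injective (by
        simp only [Prod.mk.injEq] at h
        exact Prod.ext (Subtype.ext h.1.1) h.1.2)) x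
    exact ha (hj _ _ _)
  · exact_mod_cast coveringDim_le_of_avoids_zeros (d := 1) (f := fun b j => F ((i, b), j))
      (fun b x O hO hx => exists_pos_subset_of_denseRange (hdense (i, b)) hO hx)
      fun x hx => hx
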